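/- arXiv:2209.11452 — 2 statements merged into one kernel-verified Lean document; each statement's English description precedes it below -/
import Mathlib

section
/- Let n ≥ 2 and N = 2^n. Let W ⊆ S ⊆ Fin N with |W| = N/4 and |S| = N/2. Define the initial amplitude vector a₀ : Fin N → ℝ by a₀(i) = √(2/N) if i ∈ S and a₀(i) = 0 otherwise, and let a_t = T_W^t a₀ where T_W is the modified GSA iteration for marked set W. Then for every t ≥ 0 and every marked state i ∈ W, the probability of measuring i, namely (a_t(i))², is either 0 or 2/N. -/
/-- Modified GSA iteration: with `D = (2/N) * (∑_{j ∉ W} a j - ∑_{i ∈ W} a i)`,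
the new amplitude is `D + a i` for marked states `i ∈ W` and `D - a j` otherwise. -/
noncomputable def gsaStep (N : ℕ) (W : Finset (Fin N)) (a : Fin N → ℝ) : Fin N → ℝ :=
  fun i =>
    (2 / (N : ℝ)) * ((∑ j ∈ Wᶜ, a j) - ∑ j ∈ W, a j) + (if i ∈ W then a i else - a i)

/-- If all marked amplitudes equal `x` and the unmarked ones sum to `u`, one step changes a
marked amplitude to `D + x`. -/
theorem gsaStep_apply_of_mem {N : ℕ} {W : Finset (Fin N)} {a : Fin N → ℝ} {x u : ℝ}
    (hx : ∀ i ∈ W, a i = x) (hu : ∑ j ∈ Wᶜ, a j = u) {i : Fin N} (hi : i ∈ W) :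
    gsaStep N W a i = 2 / (N : ℝ) * (u - W.card * x) + x := by
  simp [gsaStep, hi, hx i hi, hu, Finset.sum_congr rfl hx]

/-- If all marked amplitudes equal `x` and the unmarked ones sum to `u`, one step changes the
unmarked sum to `(N - |W|) D - u`. -/
theorem sum_compl_gsaStep {N : ℕ} {W : Finset (Fin N)} {a : Fin N → ℝ} {x u : ℝ}
    (hx : ∀ i ∈ W, a i = x) (hu : ∑ j ∈ Wᶜ, a j = u) :
    ∑ j ∈ Wᶜ, gsaStep N W a j =
      ((N : ℝ) - W.card) * (2 / (N : ℝ) * (u - W.card * x)) - u := by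
  have h : ∀ j ∈ Wᶜ, gsaStep N W a j = 2 / (N : ℝ) * (u - W.card * x) - a j := by
    intro j hj
    simp [gsaStep, Finset.mem_compl.mp hj, hu, Finset.sum_congr rfl hx, sub_eq_add_neg]
  have hc : ((Wᶜ.card : ℕ) : ℝ) = N - W.card := by
    rw [Finset.card_compl, Fintype.card_fin,
      Nat.cast_sub (by simpa using Finset.card_le_univ W)]
  rw [Finset.sum_congr rfl h, Finset.sum_sub_distrib, hu, Finset.sum_const, nsmul_eq_mul, hc]

/-- With `4 |W| = N`, the pair (marked amplitude, unmarked sum) stays on the orbit of period six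
through `(s, |W| s)`. -/
theorem gsaStep_iterate_orbit {N : ℕ} {W : Finset (Fin N)} (hN : 0 < N) (hW : 4 * W.card = N)
    {a : Fin N → ℝ} {s : ℝ} (hx : ∀ i ∈ W, a i = s) (hu : ∑ j ∈ Wᶜ, a j = W.card * s) (t : ℕ) :
    ∃ x y : ℝ, (∀ i ∈ W, (gsaStep N W)^[t] a i = x) ∧
      ∑ j ∈ Wᶜ, (gsaStep N W)^[t] a j = W.card * y ∧
      ((x = s ∧ y = s) ∨ (x = s ∧ y = -s) ∨ (x = 0 ∧ y = -(2 * s)) ∨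
        (x = -s ∧ y = -s) ∨ (x = -s ∧ y = s) ∨ (x = 0 ∧ y = 2 * s)) := by
  have hM : (W.card : ℝ) ≠ 0 := by
    have : W.card ≠ 0 := by omega
    exact_mod_cast this
  have hNM : (N : ℝ) = 4 * W.card := by exact_mod_cast hW.symm
  induction t with
  | zero => exact ⟨s, s, hx, hu, Or.inl ⟨rfl, rfl⟩⟩
  | succ t ih =>
    obtain ⟨x, y, hx, hu, h⟩ := ih
    refine ⟨(y - x) / 2 + x, 3 * ((y - x) / 2) - y, fun i hi => ?_, ?_, ?_⟩
    · rw [Function.iterate_succ_apply', gsaStep_apply_of_mem hx hu hi, hNM]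
      field_simp
      ring
    · rw [Function.iterate_succ_apply', sum_compl_gsaStep hx hu, hNM]
      field_simp
      ring
    · rcases h with ⟨rfl, rfl⟩ | ⟨rfl, rfl⟩ | ⟨rfl, rfl⟩ | ⟨rfl, rfl⟩ | ⟨rfl, rfl⟩ | ⟨rfl, rfl⟩
      · exact Or.inr (Or.inl ⟨by ring, by ring⟩)
      · exact Or.inr (Or.inr (Or.inl ⟨by ring, by ring⟩))
      · exact Or.inr (Or.inr (Or.inr (Or.inl ⟨by ring, by ring⟩)))
      · exact Or.inr (Or.inr (Or.inr (Or.inr (Or.inl ⟨by ring, by ring⟩))))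
      · exact Or.inr (Or.inr (Or.inr (Or.inr (Or.inr ⟨by ring, by ring⟩))))
      · exact Or.inl ⟨by ring, by ring⟩

/-- If `|W| = N/4` marked states sit inside a support `S` of size `N/2` on which the
initial amplitudes are all `√(2/N)`, then at every iteration of the modified GSA the
probability of measuring any marked state is either `0` or `2/N`. -/
theorem modifiedGSA_marked_prob_zero_or_two_div_N
    (n : ℕ) (hn : 2 ≤ n) (N : ℕ) (hN : N = 2 ^ n)
    (W S : Finset (Fin N)) (hWS : W ⊆ S)
    (hW : W.card = N / 4) (hS : S.card = N / 2)
    (a₀ : Fin N → ℝ)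
    (ha₀ : ∀ i, a₀ i = if i ∈ S then Real.sqrt (2 / (N : ℝ)) else 0) :
    ∀ t : ℕ, ∀ i ∈ W,
      ((gsaStep N W)^[t] a₀ i) ^ 2 = 0 ∨ ((gsaStep N W)^[t] a₀ i) ^ 2 = 2 / (N : ℝ) := by
  intro t i hi
  obtain ⟨k, rfl⟩ := Nat.exists_eq_add_of_le hn
  have hN4 : N = 4 * 2 ^ k := by rw [hN, pow_add]; norm_num
  have hpos : 0 < 2 ^ k := by positivity
  have hcard : 4 * W.card = N := by omega
  have hcardS : S.card = W.card + W.card := by omega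
  have hsum : ∑ j ∈ Wᶜ, a₀ j = W.card * Real.sqrt (2 / (N : ℝ)) := by
    have h := Finset.sum_add_sum_compl W a₀
    have hSW : ∑ j ∈ W, a₀ j = W.card * Real.sqrt (2 / (N : ℝ)) := by
      rw [Finset.sum_congr rfl fun j hj => (ha₀ j).trans (if_pos (hWS hj)),
        Finset.sum_const, nsmul_eq_mul]
    have hall : ∑ j, a₀ j = S.card * Real.sqrt (2 / (N : ℝ)) := by
      rw [Finset.sum_congr rfl fun j _ => ha₀ j, Finset.sum_ite_mem, Finset.univ_inter,
        Finset.sum_const, nsmul_eq_mul]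
    rw [hSW, hall, hcardS] at h
    push_cast at h
    linarith
  obtain ⟨x, y, hx, -, h⟩ := gsaStep_iterate_orbit (by omega) hcard
    (fun j hj => (ha₀ j).trans (if_pos (hWS hj))) hsum t
  have hsq : Real.sqrt (2 / (N : ℝ)) ^ 2 = 2 / (N : ℝ) := Real.sq_sqrt (by positivity)
  rw [hx i hi]
  rcases h with ⟨rfl, -⟩ | ⟨rfl, -⟩ | ⟨rfl, -⟩ | ⟨rfl, -⟩ | ⟨rfl, -⟩ | ⟨rfl, -⟩
  · exact Or.inr hsq
  · exact Or.inr hsq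
  · exact Or.inl (zero_pow two_ne_zero)
  · exact Or.inr ((neg_sq _).trans hsq)
  · exact Or.inr ((neg_sq _).trans hsq)
  · exact Or.inl (zero_pow two_ne_zero)
end

section
/- Let G : ℝ⁴ → ℝ⁴ be the modified GSA iteration for N = 4 with marked set W = {2}, and let v₀ = (1/√2)(1,0,1,0). Then for every t ≥ 0 the marked amplitude satisfies (G^t v₀)(2) ∈ {−1/√2, 0, 1/√2}; in particular the probability of measuring the marked state |10⟩, namely ((G^t v₀)(2))², is either 0 or 1/2 at every iteration. -/
theorem gsaStep_four_two (a b c d : ℝ) :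
    gsaStep 4 {2} ![a, b, c, d] =
      ![(a + b + d - c) / 2 - a, (a + b + d - c) / 2 - b,
        (a + b + d - c) / 2 + c, (a + b + d - c) / 2 - d] := by
  have hc : ({2} : Finset (Fin 4))ᶜ = {0, 1, 3} := by decide
  ext i
  fin_cases i <;> simp [gsaStep, hc] <;> ring

/-- The orbit of `(r, 0, r, 0)` runs, up to sign, through three vectors. -/
theorem gsaStep_four_two_iterate (r : ℝ) (t : ℕ) :
    ∃ s : ℝ, (s = r ∨ s = -r) ∧
      ((gsaStep 4 {2})^[t] ![r, 0, r, 0] = ![s, 0, s, 0] ∨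
        (gsaStep 4 {2})^[t] ![r, 0, r, 0] = ![-s, 0, s, 0] ∨
        (gsaStep 4 {2})^[t] ![r, 0, r, 0] = ![0, -s, 0, -s]) := by
  induction t with
  | zero => exact ⟨r, Or.inl rfl, Or.inl rfl⟩
  | succ t ih =>
    obtain ⟨s, hs, h | h | h⟩ := ih
    · refine ⟨s, hs, Or.inr (Or.inl ?_)⟩
      rw [Function.iterate_succ_apply', h, gsaStep_four_two]
      ext i
      fin_cases i <;> simp
    · refine ⟨s, hs, Or.inr (Or.inr ?_)⟩
      rw [Function.iterate_succ_apply', h, gsaStep_four_two]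
      ext i
      fin_cases i <;> simp <;> ring
    · refine ⟨-s, by rcases hs with rfl | rfl <;> simp, Or.inl ?_⟩
      rw [Function.iterate_succ_apply', h, gsaStep_four_two]
      ext i
      fin_cases i <;> simp

/-- For the modified GSA on `N = 4` states with marked set `{2}` (the state `|10⟩`) started
from `v₀ = (1/√2)(1,0,1,0)`, at every iteration the marked amplitude lies in
`{−1/√2, 0, 1/√2}`; in particular the probability of measuring the marked state is
either `0` or `1/2`. -/
theorem modifiedGSA_four_state_marked_amplitude :
    ∀ t : ℕ,
      (gsaStep 4 ({2} : Finset (Fin 4)))^[t] ((Real.sqrt 2)⁻¹ • ![1, 0, 1, 0]) 2 ∈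
        ({-(Real.sqrt 2)⁻¹, 0, (Real.sqrt 2)⁻¹} : Set ℝ) ∧
      (((gsaStep 4 ({2} : Finset (Fin 4)))^[t] ((Real.sqrt 2)⁻¹ • ![1, 0, 1, 0]) 2) ^ 2 = 0 ∨
       ((gsaStep 4 ({2} : Finset (Fin 4)))^[t] ((Real.sqrt 2)⁻¹ • ![1, 0, 1, 0]) 2) ^ 2 = 1 / 2) := by
  intro t
  have hv : (Real.sqrt 2)⁻¹ • ![1, 0, 1, 0] =
      ![(Real.sqrt 2)⁻¹, 0, (Real.sqrt 2)⁻¹, 0] := by simp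
  rw [hv]
  obtain ⟨s, rfl | rfl, h | h | h⟩ := gsaStep_four_two_iterate (Real.sqrt 2)⁻¹ t <;>
    rw [h] <;> simp
end
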